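/- Let E ⊂ R^d be compact with C^{1,1} boundary, 0 ∈ ∂E with outer normal e_d, and suppose B_δ(−δe_d) ⊆ E and B_δ(δe_d) ⊆ R^d \ E for some δ > 0. Then as s → 0+, s · H^s(0, E) → d ω_d, where H^s is the s-fractional curvature. -/

import Mathlib

open MeasureTheory Metric Filter Set

/-- Volume of the unit ball in `ℝ^d` (the constant `ω_d`). -/
noncomputable def unitBallVol (d : ℕ) : ℝ :=
  (volume (Metric.ball (0 : EuclideanSpace ℝ (Fin d)) 1)).toReal

/-- `χ_{ℝ^d ∖ E}(y) - χ_E(y)`. -/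
noncomputable def chiDiff {d : ℕ} (E : Set (EuclideanSpace ℝ (Fin d)))
    (y : EuclideanSpace ℝ (Fin d)) : ℝ :=
  Set.indicator Eᶜ (fun _ => (1:ℝ)) y - Set.indicator E (fun _ => (1:ℝ)) y

/-- The unit vector `e_d` (last coordinate direction) in `ℝ^d`. -/
noncomputable def ed (d : ℕ) : EuclideanSpace ℝ (Fin d) :=
  if h : 0 < d then EuclideanSpace.single (⟨d - 1, by omega⟩ : Fin d) 1 else 0

/-- `H` is the value of the `s`-fractional curvature of `E` at `x`, defined as the
principal value `lim_{r→0⁺} ∫_{ℝ^d ∖ B_r(x)} (χ_{Eᶜ}(y) - χ_E(y))/|x-y|^{d+s} dy`. -/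
def HasFracCurv {d : ℕ} (s : ℝ) (E : Set (EuclideanSpace ℝ (Fin d)))
    (x : EuclideanSpace ℝ (Fin d)) (H : ℝ) : Prop :=
  Tendsto (fun r : ℝ => ∫ y in (Metric.ball x r)ᶜ, chiDiff E y / ‖y - x‖ ^ ((d:ℝ) + s))
    (nhdsWithin 0 (Set.Ioi 0)) (nhds H)

/-- Uniform two-sided (interior and exterior) tangent ball condition: the standard
geometric characterization of a set with compact boundary of class `C^{1,1}`. -/
def TwoSidedBallCond {d : ℕ} (E : Set (EuclideanSpace ℝ (Fin d))) : Prop :=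
  ∃ δ > 0, ∀ x ∈ frontier E, ∃ ν : EuclideanSpace ℝ (Fin d), ‖ν‖ = 1 ∧
    Metric.ball (x - δ • ν) δ ⊆ E ∧ Metric.ball (x + δ • ν) δ ⊆ Eᶜ

/-- The `0`-fractional curvature `H^0(x,E)`, defined with the cutoff radius
`R = diam E + 1 > diam E` (the value is independent of the choice of `R > diam E`). -/
noncomputable def H0 {d : ℕ} (E : Set (EuclideanSpace ℝ (Fin d)))
    (x : EuclideanSpace ℝ (Fin d)) : ℝ :=
  limUnder (nhdsWithin (0:ℝ) (Set.Ioi 0))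
    (fun r => ∫ y in Metric.ball x (Metric.diam E + 1) \ Metric.ball x r,
      chiDiff E y / ‖y - x‖ ^ (d:ℝ))
  - d * unitBallVol d * Real.log (Metric.diam E + 1)

/-- The `s`-Riesz curvature `K^s(x,E) = -2 ∫_E |x-y|^{-(d+s)} dy` of a compact set. -/
noncomputable def Ks {d : ℕ} (s : ℝ) (E : Set (EuclideanSpace ℝ (Fin d)))
    (x : EuclideanSpace ℝ (Fin d)) : ℝ :=
  -2 * ∫ y in E, 1 / ‖x - y‖ ^ ((d:ℝ) + s)

/-- Outer Minkowski curvature `κ_r^{ou}(x,E)` relative to a normal (vector) field `ν`. -/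
noncomputable def kappaOut {d : ℕ} (E : Set (EuclideanSpace ℝ (Fin d)))
    (ν : EuclideanSpace ℝ (Fin d) → EuclideanSpace ℝ (Fin d)) (r : ℝ)
    (x : EuclideanSpace ℝ (Fin d)) : ℝ :=
  if Metric.infDist (x + r • ν x) E = r then
    (1 / (2 * r)) * LinearMap.det
      ((ContinuousLinearMap.id ℝ (EuclideanSpace ℝ (Fin d)) + r • fderiv ℝ ν x).toLinearMap)
  else 0

/-- Inner Minkowski curvature `κ_r^{in}(x,E)` relative to a normal (vector) field `ν`. -/
noncomputable def kappaIn {d : ℕ} (E : Set (EuclideanSpace ℝ (Fin d)))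
    (ν : EuclideanSpace ℝ (Fin d) → EuclideanSpace ℝ (Fin d)) (r : ℝ)
    (x : EuclideanSpace ℝ (Fin d)) : ℝ :=
  if Metric.infDist (x - r • ν x) Eᶜ = r then
    -(1 / (2 * r)) * LinearMap.det
      ((ContinuousLinearMap.id ℝ (EuclideanSpace ℝ (Fin d)) - r • fderiv ℝ ν x).toLinearMap)
  else 0

/-- Regularized Minkowski curvature `κ_r^f(x,E) = ∫_0^1 (-s f'(s)) κ_{rs}(x,E) ds`. -/
noncomputable def kappaF {d : ℕ} (f : ℝ → ℝ) (E : Set (EuclideanSpace ℝ (Fin d)))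
    (ν : EuclideanSpace ℝ (Fin d) → EuclideanSpace ℝ (Fin d)) (r : ℝ)
    (x : EuclideanSpace ℝ (Fin d)) : ℝ :=
  ∫ t in Set.Ioc (0:ℝ) 1, (-t * deriv f t) * (kappaOut E ν (r*t) x + kappaIn E ν (r*t) x)

open scoped Topology

/-- Outside the two balls of radius `δ` tangent at the origin to the hyperplane `yᵢ = 0`, the
kernel `‖y‖^{-(d+s)}` is integrable near the origin for `s < 1`. -/
lemma integrableOn_inv_norm_rpow_tangential {d : ℕ} (i : Fin d) {s δ : ℝ} (hs0 : 0 < s)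
    (hs1 : s < 1) (hδ : 0 < δ) :
    IntegrableOn (fun y : EuclideanSpace ℝ (Fin d) => 1 / ‖y‖ ^ ((d : ℝ) + s))
      ({y | 2 * δ * |y i| ≤ ‖y‖ ^ 2} ∩ ball 0 1) := by
  have hd : (1 : ℝ) ≤ d := by exact_mod_cast i.pos
  obtain ⟨t, ht⟩ : ∃ t : ℝ, t = (3 + s) / 4 := ⟨_, rfl⟩
  obtain ⟨a, ha⟩ : ∃ a : ℝ, a = 1 - ((1 - s) / 2) / d := ⟨_, rfl⟩
  have hda : d * a = d - (1 - s) / 2 := by rw [ha]; field_simp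
  have ha1 : a < 1 := by
    have : 0 < ((1 - s) / 2) / d := by apply div_pos <;> linarith
    linarith
  have ha0 : 0 ≤ a := by
    by_contra! h
    nlinarith
  let b : Fin d → ℝ := fun j => if j = i then t else a
  have hb : ∀ j, b j < 1 := by
    intro j
    by_cases h : j = i
    · simp only [b, h, if_true]; linarith
    · simp only [b, h, if_false]; linarith
  have h1 : ∀ j, Integrable ((Icc (-1 : ℝ) 1).indicator fun x => ‖x‖ ^ (-b j)) := by
    intro j
    rw [integrable_indicator_iff measurableSet_Icc]
    refine LocallyIntegrable.integrableOn_isCompact ?_ isCompact_Icc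
    refine locallyIntegrable_of_norm_le_rpow (μ := volume) (C := 1) (α := b j)
      (f := fun x : ℝ => ‖x‖ ^ (-b j)) (by simp) (by simpa using hb j)
      (.of_forall fun x => ?_) (measurable_norm.pow_const _).aestronglyMeasurable
    rw [one_mul, Real.norm_of_nonneg (by positivity)]
  have h2 : Integrable (fun y : EuclideanSpace ℝ (Fin d) =>
      ∏ j, (Icc (-1 : ℝ) 1).indicator (fun x => ‖x‖ ^ (-b j)) (y j)) :=
    ((PiLp.volume_preserving_ofLp (Fin d)).integrable_comp_emb
      (MeasurableEquiv.toLp 2 (Fin d → ℝ)).symm.measurableEmbedding).2 (Integrable.fintype_prod h1)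
  have hne : ∀ᵐ y : EuclideanSpace ℝ (Fin d), ∀ j, y j ≠ 0 := by
    have h : ∀ᵐ z : Fin d → ℝ, ∀ j, z j ≠ 0 :=
      ae_all_iff.2 fun j => Measure.ae_eval_ne (fun _ => volume) j 0
    exact (PiLp.volume_preserving_ofLp (Fin d)).quasiMeasurePreserving.ae h
  have hS : MeasurableSet
      ({y : EuclideanSpace ℝ (Fin d) | 2 * δ * |y i| ≤ ‖y‖ ^ 2} ∩ ball 0 1) :=
    (measurableSet_le (by fun_prop) (by fun_prop)).inter measurableSet_ball
  refine Integrable.mono' ((h2.const_mul ((2 * δ) ^ (-t))).integrableOn)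
    (Measurable.aestronglyMeasurable (by fun_prop)) ?_
  filter_upwards [ae_restrict_mem hS, ae_restrict_of_ae hne] with y ⟨hy, hy1⟩ hy0
  have hle : ∀ j, |y j| ≤ ‖y‖ := fun j => PiLp.norm_apply_le y j
  have hpos : ∀ j, 0 < |y j| := fun j => abs_pos.2 (hy0 j)
  have hn : 0 < ‖y‖ := (hpos i).trans_le (hle i)
  have hn1 : ‖y‖ < 1 := by simpa using hy1
  have hprod : ∏ j, (Icc (-1 : ℝ) 1).indicator (fun x => ‖x‖ ^ (-b j)) (y j)
      = |y i| ^ (-t) * ∏ j ∈ Finset.univ.erase i, |y j| ^ (-a) := by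
    rw [← Finset.mul_prod_erase _ _ (Finset.mem_univ i)]
    have hm : ∀ j, y j ∈ Icc (-1 : ℝ) 1 := fun j => abs_le.1 ((hle j).trans hn1.le)
    congr 1
    · simp [indicator_of_mem (hm i), b]
    · refine Finset.prod_congr rfl fun j hj => ?_
      simp [indicator_of_mem (hm j), b, Finset.ne_of_mem_erase hj]
  have hA : ‖y‖ ^ (-(2 * t)) ≤ (2 * δ) ^ (-t) * |y i| ^ (-t) := by
    rw [← Real.mul_rpow (by positivity) (by positivity),
      show -(2 * t) = (2 : ℕ) * (-t) by push_cast; ring, Real.rpow_mul hn.le, Real.rpow_natCast]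
    exact Real.rpow_le_rpow_of_nonpos (mul_pos (by positivity) (hpos i)) hy (by linarith)
  have hB : ‖y‖ ^ (-(d + s - 2 * t)) ≤ ∏ j ∈ Finset.univ.erase i, |y j| ^ (-a) := by
    calc ‖y‖ ^ (-(d + s - 2 * t)) ≤ ‖y‖ ^ (-a * ((d - 1 : ℕ) : ℝ)) := by
          refine Real.rpow_le_rpow_of_exponent_ge hn hn1.le ?_
          rw [Nat.cast_sub i.pos]
          push_cast
          nlinarith
      _ = ∏ j ∈ Finset.univ.erase i, ‖y‖ ^ (-a) := by
          rw [Finset.prod_const, Finset.card_erase_of_mem (Finset.mem_univ i), Finset.card_univ,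
            Fintype.card_fin, Real.rpow_mul_natCast hn.le]
      _ ≤ _ := Finset.prod_le_prod (fun j _ => by positivity) fun j _ =>
          Real.rpow_le_rpow_of_nonpos (hpos j) (hle j) (by linarith)
  rw [hprod, Real.norm_of_nonneg (by positivity), one_div, ← Real.rpow_neg hn.le, ← mul_assoc,
    show -(d + s) = -(2 * t) + -(d + s - 2 * t) by ring, Real.rpow_add hn]
  exact mul_le_mul hA hB (by positivity) (by positivity)

lemma indicator_compl_ball_comp_norm {V : Type*} [NormedAddCommGroup V] (R : ℝ) (f : ℝ → ℝ) :
    (ball (0 : V) R)ᶜ.indicator (fun y => f ‖y‖) = fun y => (Ici R).indicator f ‖y‖ := by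
  ext y
  by_cases h : R ≤ ‖y‖ <;> simp [indicator, h, not_lt]

lemma integrableOn_compl_ball_inv_norm_rpow {d : ℕ} (hd : 0 < d) {s R : ℝ} (hs : 0 < s)
    (hR : 0 < R) :
    IntegrableOn (fun y : EuclideanSpace ℝ (Fin d) => 1 / ‖y‖ ^ ((d : ℝ) + s)) (ball 0 R)ᶜ ∧
    ∫ y in (ball (0 : EuclideanSpace ℝ (Fin d)) R)ᶜ, 1 / ‖y‖ ^ ((d : ℝ) + s)
      = d * unitBallVol d * (R ^ (-s) / s) := by
  have : NeZero d := ⟨hd.ne'⟩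
  have hcongr : ∀ x ∈ Ici R, x ^ (d - 1) • (1 / x ^ ((d : ℝ) + s)) = x ^ (-1 - s) := by
    intro x hx
    have hx : 0 < x := hR.trans_le hx
    rw [smul_eq_mul, one_div, ← Real.rpow_neg hx.le, ← Real.rpow_natCast, ← Real.rpow_add hx,
      Nat.cast_sub hd]
    congr 1
    push_cast
    ring
  have hmul : (fun x : ℝ => x ^ (d - 1) • (Ici R).indicator (fun r => 1 / r ^ ((d : ℝ) + s)) x)
      = (Ici R).indicator fun x => x ^ (-1 - s) := by
    ext x
    by_cases h : x ∈ Ici R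
    · rw [indicator_of_mem h, indicator_of_mem h, hcongr x h]
    · rw [indicator_of_notMem h, indicator_of_notMem h, smul_zero]
  have hinteg : Integrable ((Ici R).indicator fun x : ℝ => x ^ (-1 - s)) := by
    rw [integrable_indicator_iff measurableSet_Ici, integrableOn_Ici_iff_integrableOn_Ioi]
    exact integrableOn_Ioi_rpow_of_lt (by linarith) hR
  constructor
  · rw [← integrable_indicator_iff measurableSet_ball.compl,
      indicator_compl_ball_comp_norm R (fun r => 1 / r ^ ((d : ℝ) + s)),
      integrable_fun_norm_addHaar, finrank_euclideanSpace_fin, hmul]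
    exact hinteg.integrableOn
  · rw [← integral_indicator measurableSet_ball.compl,
      indicator_compl_ball_comp_norm R (fun r => 1 / r ^ ((d : ℝ) + s)),
      integral_fun_norm_addHaar volume, finrank_euclideanSpace_fin, hmul,
      setIntegral_indicator measurableSet_Ici,
      inter_eq_right.2 (Ici_subset_Ioi.2 hR),
      integral_Ici_eq_integral_Ioi, integral_Ioi_rpow_of_lt (by linarith) hR,
      nsmul_eq_mul, smul_eq_mul, mul_assoc, unitBallVol, Measure.real,
      show -1 - s + 1 = -s by ring, neg_div_neg_eq]

lemma abs_chiDiff_le_one {d : ℕ} (E : Set (EuclideanSpace ℝ (Fin d)))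
    (y : EuclideanSpace ℝ (Fin d)) : |chiDiff E y| ≤ 1 := by
  by_cases h : y ∈ E <;> simp [chiDiff, h]

lemma measurable_chiDiff {d : ℕ} {E : Set (EuclideanSpace ℝ (Fin d))} (hE : MeasurableSet E) :
    Measurable (chiDiff E) :=
  (measurable_const.indicator hE.compl).sub (measurable_const.indicator hE)

/-- The even part of `χ_{Eᶜ} - χ_E`. -/
noncomputable def chiDiffEven {d : ℕ} (E : Set (EuclideanSpace ℝ (Fin d)))
    (y : EuclideanSpace ℝ (Fin d)) : ℝ :=
  (chiDiff E y + chiDiff E (-y)) / 2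

lemma abs_chiDiffEven_le_one {d : ℕ} (E : Set (EuclideanSpace ℝ (Fin d)))
    (y : EuclideanSpace ℝ (Fin d)) : |chiDiffEven E y| ≤ 1 := by
  have h1 := abs_le.1 (abs_chiDiff_le_one E y)
  have h2 := abs_le.1 (abs_chiDiff_le_one E (-y))
  rw [chiDiffEven, abs_le]
  constructor <;> linarith

lemma measurable_chiDiffEven {d : ℕ} {E : Set (EuclideanSpace ℝ (Fin d))}
    (hE : MeasurableSet E) : Measurable (chiDiffEven E) :=
  ((measurable_chiDiff hE).add ((measurable_chiDiff hE).comp measurable_neg)).div_const 2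

lemma chiDiffEven_neg {d : ℕ} (E : Set (EuclideanSpace ℝ (Fin d)))
    (y : EuclideanSpace ℝ (Fin d)) : chiDiffEven E (-y) = chiDiffEven E y := by
  rw [chiDiffEven, chiDiffEven, neg_neg, add_comm]

/-- A point with `‖y‖² < 2 * δ * y i` lies in the ball of radius `δ` tangent at the origin. -/
lemma mem_ball_smul_single {d : ℕ} {i : Fin d} {δ : ℝ} (hδ : 0 < δ)
    {y : EuclideanSpace ℝ (Fin d)} (hy : ‖y‖ ^ 2 < 2 * δ * y i) :
    y ∈ ball (δ • EuclideanSpace.single i (1 : ℝ)) δ := by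
  rw [mem_ball, dist_eq_norm]
  refine lt_of_pow_lt_pow_left₀ 2 hδ.le ?_
  rw [norm_sub_sq_real, inner_smul_right, norm_smul, EuclideanSpace.inner_single_right,
    PiLp.norm_single]
  simp
  linarith

lemma chiDiffEven_eq_zero {d : ℕ} {E : Set (EuclideanSpace ℝ (Fin d))} {i : Fin d} {δ : ℝ}
    (hδ : 0 < δ) (hin : ball (-(δ • EuclideanSpace.single i (1 : ℝ))) δ ⊆ E)
    (hout : ball (δ • EuclideanSpace.single i (1 : ℝ)) δ ⊆ Eᶜ)
    {y : EuclideanSpace ℝ (Fin d)} (hy : ‖y‖ ^ 2 < 2 * δ * |y i|) : chiDiffEven E y = 0 := by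
  have key : ∀ z : EuclideanSpace ℝ (Fin d), ‖z‖ ^ 2 < 2 * δ * z i → chiDiffEven E z = 0 := by
    intro z hz
    have h1 : z ∉ E := hout (mem_ball_smul_single hδ hz)
    have h2 : -z ∈ E := by
      apply hin
      have := mem_ball_smul_single hδ hz
      rwa [mem_ball, ← dist_neg_neg, ← mem_ball] at this
    simp [chiDiffEven, chiDiff, h1, h2]
  rcases abs_cases (y i) with ⟨h, -⟩ | ⟨h, -⟩
  · exact key y (h ▸ hy)
  · rw [← chiDiffEven_neg]
    refine key (-y) ?_
    rw [norm_neg, PiLp.neg_apply, ← h]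
    exact hy

lemma setIntegral_compl_ball_chiDiff {d : ℕ} {E : Set (EuclideanSpace ℝ (Fin d))} (hd : 0 < d)
    (hE : MeasurableSet E) {s r : ℝ} (hs : 0 < s) (hr : 0 < r) :
    ∫ y in (ball 0 r)ᶜ, chiDiff E y / ‖y‖ ^ ((d : ℝ) + s)
      = ∫ y in (ball 0 r)ᶜ, chiDiffEven E y / ‖y‖ ^ ((d : ℝ) + s) := by
  have hS : MeasurableSet (ball (0 : EuclideanSpace ℝ (Fin d)) r)ᶜ := measurableSet_ball.compl
  have hinteg : IntegrableOn (fun y => chiDiff E y / ‖y‖ ^ ((d : ℝ) + s)) (ball 0 r)ᶜ := by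
    refine (integrableOn_compl_ball_inv_norm_rpow hd hs hr).1.mono'
      (((measurable_chiDiff hE).div (by fun_prop)).aestronglyMeasurable)
      (.of_forall fun y => ?_)
    rw [norm_div, Real.norm_eq_abs, Real.norm_of_nonneg (by positivity)]
    exact div_le_div_of_nonneg_right (abs_chiDiff_le_one E y) (by positivity)
  have hpre : Neg.neg ⁻¹' (ball (0 : EuclideanSpace ℝ (Fin d)) r)ᶜ = (ball 0 r)ᶜ := by
    ext y; simp
  have hmp := Measure.measurePreserving_neg (volume : Measure (EuclideanSpace ℝ (Fin d)))
  have hemb := (MeasurableEquiv.neg (EuclideanSpace ℝ (Fin d))).measurableEmbedding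
  have hneg : ∫ y in (ball 0 r)ᶜ, chiDiff E (-y) / ‖y‖ ^ ((d : ℝ) + s)
      = ∫ y in (ball 0 r)ᶜ, chiDiff E y / ‖y‖ ^ ((d : ℝ) + s) := by
    have := hmp.setIntegral_preimage_emb hemb
      (fun y => chiDiff E y / ‖y‖ ^ ((d : ℝ) + s)) (ball 0 r)ᶜ
    simpa only [hpre, norm_neg] using this
  have hinteg' : IntegrableOn (fun y => chiDiff E (-y) / ‖y‖ ^ ((d : ℝ) + s)) (ball 0 r)ᶜ := by
    have := (hmp.integrableOn_comp_preimage hemb).2 hinteg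
    simpa only [hpre, Function.comp_def, norm_neg] using this
  have hsplit : ∀ y, chiDiffEven E y / ‖y‖ ^ ((d : ℝ) + s)
      = (chiDiff E y / ‖y‖ ^ ((d : ℝ) + s) + chiDiff E (-y) / ‖y‖ ^ ((d : ℝ) + s)) / 2 := by
    intro y
    rw [chiDiffEven]
    ring
  simp_rw [hsplit]
  rw [integral_div, integral_add hinteg hinteg', hneg]
  ring

/-- Near the origin the symmetrized kernels with `s ≤ s'` are dominated by the kernel
with exponent `s'` restricted to the tangential region, up to a bounded term. -/
lemma norm_chiDiffEven_div_le {d : ℕ} {E : Set (EuclideanSpace ℝ (Fin d))} {i : Fin d} {δ : ℝ}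
    (hδ : 0 < δ) (hin : ball (-(δ • EuclideanSpace.single i (1 : ℝ))) δ ⊆ E)
    (hout : ball (δ • EuclideanSpace.single i (1 : ℝ)) δ ⊆ Eᶜ) {s s' : ℝ} (hs : 0 < s)
    (hss : s ≤ s') (y : EuclideanSpace ℝ (Fin d)) :
    ‖chiDiffEven E y / ‖y‖ ^ ((d : ℝ) + s)‖ ≤
      ({y | 2 * δ * |y i| ≤ ‖y‖ ^ 2} ∩ ball 0 1).indicator
        (fun y => 1 / ‖y‖ ^ ((d : ℝ) + s')) y + 1 := by
  have hind : 0 ≤ ({y : EuclideanSpace ℝ (Fin d) | 2 * δ * |y i| ≤ ‖y‖ ^ 2} ∩ ball 0 1).indicator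
      (fun y => 1 / ‖y‖ ^ ((d : ℝ) + s')) y := indicator_nonneg (fun _ _ => by positivity) y
  rcases lt_or_ge (‖y‖ ^ 2) (2 * δ * |y i|) with h | h
  · rw [chiDiffEven_eq_zero hδ hin hout h, zero_div, norm_zero]
    positivity
  have hle : ‖chiDiffEven E y / ‖y‖ ^ ((d : ℝ) + s)‖ ≤ 1 / ‖y‖ ^ ((d : ℝ) + s) := by
    rw [norm_div, Real.norm_eq_abs, Real.norm_of_nonneg (by positivity)]
    exact div_le_div_of_nonneg_right (abs_chiDiffEven_le_one E y) (by positivity)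
  refine hle.trans ?_
  rcases lt_or_ge ‖y‖ 1 with h1 | h1
  · have hmem : y ∈ {y : EuclideanSpace ℝ (Fin d) | 2 * δ * |y i| ≤ ‖y‖ ^ 2} ∩ ball 0 1 :=
      ⟨h, by simpa using h1⟩
    rw [indicator_of_mem hmem]
    rcases (norm_nonneg y).eq_or_lt with h0 | h0
    · rw [← h0, Real.zero_rpow (by positivity), div_zero]
      positivity
    · refine (one_div_le_one_div_of_le (by positivity)
        (Real.rpow_le_rpow_of_exponent_ge h0 h1.le ?_)).trans (le_add_of_nonneg_right zero_le_one)
      linarith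
  · refine le_add_of_nonneg_of_le hind (div_le_one_of_le₀ ?_ (by positivity))
    exact Real.one_le_rpow h1 (by positivity)

/-- for a compact set with interior/exterior tangent balls of radius `δ`
at `0 ∈ ∂E` (outer normal `e_d`), the `s`-fractional curvatures `H^s(0,E)` exist and
`s · H^s(0,E) → d ω_d` as `s → 0⁺`. -/
theorem stmt_7 (d : ℕ) (hd : 0 < d) (E : Set (EuclideanSpace ℝ (Fin d)))
    (hEc : IsCompact E) (h0 : (0 : EuclideanSpace ℝ (Fin d)) ∈ frontier E)
    (δ : ℝ) (hδ : 0 < δ)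
    (hin : Metric.ball (-(δ • ed d)) δ ⊆ E)
    (hout : Metric.ball (δ • ed d) δ ⊆ Eᶜ) :
    ∃ Hs : ℝ → ℝ, (∀ s ∈ Set.Ioo (0:ℝ) 1, HasFracCurv s E 0 (Hs s)) ∧
      Tendsto (fun s => s * Hs s) (nhdsWithin 0 (Set.Ioi 0))
        (nhds ((d : ℝ) * unitBallVol d)) := by
  obtain ⟨i, hi⟩ : ∃ i : Fin d, ed d = EuclideanSpace.single i 1 := ⟨_, dif_pos hd⟩
  rw [hi] at hin hout
  have hE : MeasurableSet E := hEc.isClosed.measurableSet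
  obtain ⟨R, hR, hER⟩ : ∃ R, 0 < R ∧ E ⊆ ball (0 : EuclideanSpace ℝ (Fin d)) R := by
    obtain ⟨R, hR⟩ := hEc.isBounded.subset_ball (0 : EuclideanSpace ℝ (Fin d))
    exact ⟨max R 1, by positivity, hR.trans (ball_subset_ball (le_max_left _ _))⟩
  let h : ℝ → EuclideanSpace ℝ (Fin d) → ℝ := fun s y => chiDiffEven E y / ‖y‖ ^ ((d : ℝ) + s)
  let K : ℝ → EuclideanSpace ℝ (Fin d) → ℝ := fun s y =>
    ({y | 2 * δ * |y i| ≤ ‖y‖ ^ 2} ∩ ball 0 1).indicator (fun y => 1 / ‖y‖ ^ ((d : ℝ) + s)) y + 1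
  have hK : ∀ s ∈ Ioo (0 : ℝ) 1, IntegrableOn (K s) (ball 0 R) := fun s hs =>
    ((integrable_indicator_iff ((measurableSet_le (by fun_prop) (by fun_prop)).inter
      measurableSet_ball)).2
      (integrableOn_inv_norm_rpow_tangential i hs.1 hs.2 hδ)).integrableOn.add
      (integrableOn_const measure_ball_lt_top.ne)
  have hhK : ∀ s s' : ℝ, 0 < s → s ≤ s' → ∀ y, ‖h s y‖ ≤ K s' y := fun s s' hs hss y =>
    norm_chiDiffEven_div_le hδ hin hout hs hss y
  have hfar : ∀ s, ∀ y ∈ (ball (0 : EuclideanSpace ℝ (Fin d)) R)ᶜ,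
      h s y = 1 / ‖y‖ ^ ((d : ℝ) + s) := by
    intro s y hy
    have h1 : y ∉ E := fun hyE => hy (hER hyE)
    have h2 : -y ∉ E := fun hyE => hy (by simpa using hER hyE)
    simp [h, chiDiffEven, chiDiff, h1, h2]
  have hin_ball : ∀ s ∈ Ioo (0 : ℝ) 1, IntegrableOn (h s) (ball 0 R) := fun s hs =>
    (hK s hs).mono' ((measurable_chiDiffEven hE).div (by fun_prop)).aestronglyMeasurable
      (.of_forall (hhK s s hs.1 le_rfl))
  have hin_compl : ∀ s, 0 < s → IntegrableOn (h s) (ball 0 R)ᶜ := fun s hs =>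
    (integrableOn_compl_ball_inv_norm_rpow hd hs hR).1.congr_fun
      (fun y hy => (hfar s y hy).symm) measurableSet_ball.compl
  have hinteg : ∀ s ∈ Ioo (0 : ℝ) 1, Integrable (h s) := fun s hs => by
    simpa using (hin_ball s hs).union (hin_compl s hs.1)
  refine ⟨fun s => ∫ y, h s y, fun s hs => ?_, ?_⟩
  · have : Nonempty (Fin d) := ⟨i⟩
    have hcover : AECover (volume : Measure (EuclideanSpace ℝ (Fin d))) (𝓝[>] (0 : ℝ))
        fun r => (ball 0 r)ᶜ := by
      refine ⟨?_, fun r => measurableSet_ball.compl⟩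
      filter_upwards [Measure.ae_ne volume (0 : EuclideanSpace ℝ (Fin d))] with y hy
      filter_upwards [Ioo_mem_nhdsGT (norm_pos_iff.2 hy)] with r hr
      simpa using hr.2.le
    refine (hcover.integral_tendsto_of_countably_generated (hinteg s hs)).congr' ?_
    filter_upwards [self_mem_nhdsWithin] with r hr
    simp only [sub_zero]
    exact (setIntegral_compl_ball_chiDiff hd hE hs.1 hr).symm
  · have hsplit : ∀ᶠ s in 𝓝[>] (0 : ℝ), s * (∫ y in ball 0 R, h s y)
        + d * unitBallVol d * R ^ (-s) = s * ∫ y, h s y := by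
      filter_upwards [Ioo_mem_nhdsGT one_pos] with s hs
      have hs0 : s ≠ 0 := hs.1.ne'
      rw [← integral_add_compl measurableSet_ball (hinteg s hs),
        setIntegral_congr_fun measurableSet_ball.compl (hfar s),
        (integrableOn_compl_ball_inv_norm_rpow hd hs.1 hR).2]
      field_simp
    refine Tendsto.congr' hsplit ?_
    have hid : Tendsto (fun s : ℝ => s) (𝓝[>] 0) (𝓝 0) := tendsto_id.mono_left nhdsWithin_le_nhds
    have hnear : Tendsto (fun s => s * ∫ y in ball 0 R, h s y) (𝓝[>] 0) (𝓝 0) := by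
      refine squeeze_zero_norm' (a := fun s => s * ∫ y in ball 0 R, K (1 / 2) y) ?_ ?_
      · filter_upwards [Ioc_mem_nhdsGT (one_half_pos : (0 : ℝ) < 1 / 2)] with s hs
        rw [norm_mul, Real.norm_of_nonneg hs.1.le]
        exact mul_le_mul_of_nonneg_left
          (norm_integral_le_of_norm_le (hK (1 / 2) (by norm_num))
            (.of_forall (hhK s _ hs.1 hs.2))) hs.1.le
      · simpa using hid.mul_const _
    have hpow : Tendsto (fun s : ℝ => R ^ (-s)) (𝓝[>] 0) (𝓝 1) := by
      have := (tendsto_const_nhds (x := R)).rpow hid.neg (Or.inl hR.ne')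
      simpa using this
    simpa using hnear.add (hpow.const_mul (d * unitBallVol d))
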